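/- The interval [L, U] is nonempty and consists of minimizers: L ≤ U, and every t ∈ ℝ with L ≤ t ≤ U satisfies max over j of (θ j + p j · t) = μ; in particular the infimum of the max-plus polynomial is attained. -/

import Mathlib

open Finset

/-- Finite maximum over `Fin n` (nonempty since `NeZero n`). -/
noncomputable def fmax {n : ℕ} [NeZero n] (f : Fin n → ℝ) : ℝ :=
  Finset.univ.sup' Finset.univ_nonempty f

lemma crossing_value_le_iff {p q x y m : ℝ} (hp : p < 0) (hq : 0 < q) :
    ((-q) * x + p * y) / (p - q) ≤ m ↔ (m - x) / p ≤ (m - y) / q := by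
  rw [div_le_iff_of_neg (by linarith), div_le_iff_of_neg hp, div_mul_eq_mul_div,
    div_le_iff₀ hq]
  constructor <;> intro h <;> linarith

lemma crossing_value_le_max {p q : ℝ} (hp : p < 0) (hq : 0 < q) (x y t : ℝ) :
    ((-q) * x + p * y) / (p - q) ≤ max (x + p * t) (y + q * t) := by
  rw [div_le_iff_of_neg (by linarith)]
  have hx := le_max_left (x + p * t) (y + q * t)
  have hy := le_max_right (x + p * t) (y + q * t)
  nlinarith [mul_le_mul_of_nonneg_left hx hq.le, mul_le_mul_of_nonpos_left hy hp.le]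

lemma le_fmax {n : ℕ} [NeZero n] (f : Fin n → ℝ) (j : Fin n) : f j ≤ fmax f :=
  Finset.le_sup' f (Finset.mem_univ j)

/-- `[L, U]` is nonempty and consists of minimizers; in particular
the infimum of the max-plus polynomial is attained. -/
theorem tropical_poly_interval_of_minimizers (N : ℕ) [NeZero N] (p θ : Fin N → ℝ)
    (a b : Fin N) (ha : p a < 0) (hb : 0 < p b) (μ L U : ℝ)
    (hμ : μ =
      ((Finset.univ.filter (fun jk : Fin N × Fin N => p jk.1 < 0 ∧ 0 < p jk.2)).image
          (fun jk => ((-p jk.2) * θ jk.1 + p jk.1 * θ jk.2) / (p jk.1 - p jk.2)) ∪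
        (Finset.univ.filter (fun j => p j = 0)).image θ).max'
        (Finset.Nonempty.inl (Finset.image_nonempty.mpr
          ⟨(a, b), Finset.mem_filter.mpr ⟨Finset.mem_univ _, ha, hb⟩⟩)))
    (hL : L = (Finset.univ.filter (fun j => p j < 0)).sup'
      ⟨a, Finset.mem_filter.mpr ⟨Finset.mem_univ _, ha⟩⟩ (fun j => (μ - θ j) / p j))
    (hU : U = (Finset.univ.filter (fun j => 0 < p j)).inf'
      ⟨b, Finset.mem_filter.mpr ⟨Finset.mem_univ _, hb⟩⟩ (fun j => (μ - θ j) / p j)) :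
    L ≤ U ∧ (∀ t : ℝ, L ≤ t → t ≤ U → fmax (fun j => θ j + p j * t) = μ) ∧
      ∃ t : ℝ, fmax (fun j => θ j + p j * t) = ⨅ s : ℝ, fmax (fun j => θ j + p j * s) := by
  obtain ⟨hcross, hzero⟩ : (∀ j k, p j < 0 → 0 < p k →
      ((-p k) * θ j + p j * θ k) / (p j - p k) ≤ μ) ∧ ∀ j, p j = 0 → θ j ≤ μ := by
    rw [hμ]
    refine ⟨fun j k hj hk => Finset.le_max' _ _ (Finset.mem_union_left _ ?_),
      fun j hj => Finset.le_max' _ _ (Finset.mem_union_right _ ?_)⟩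
    · exact Finset.mem_image.mpr ⟨(j, k), by simp [hj, hk], rfl⟩
    · exact Finset.mem_image.mpr ⟨j, by simp [hj], rfl⟩
  have hlower : ∀ t, μ ≤ fmax (fun j => θ j + p j * t) := by
    intro t
    rw [hμ]
    refine Finset.max'_le _ _ _ fun x hx => ?_
    simp only [Finset.mem_union, Finset.mem_image, Finset.mem_filter, Finset.mem_univ,
      true_and] at hx
    rcases hx with ⟨⟨j, k⟩, ⟨hj, hk⟩, rfl⟩ | ⟨j, hj, rfl⟩
    · exact (crossing_value_le_max hj hk (θ j) (θ k) t).trans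
        (max_le (le_fmax (fun j => θ j + p j * t) j) (le_fmax (fun j => θ j + p j * t) k))
    · simpa [hj] using le_fmax (fun j => θ j + p j * t) j
  have hLU : L ≤ U := by
    rw [hL, hU]
    refine Finset.sup'_le _ _ fun j hj => Finset.le_inf' _ _ fun k hk => ?_
    have hj := (Finset.mem_filter.mp hj).2
    have hk := (Finset.mem_filter.mp hk).2
    exact (crossing_value_le_iff hj hk).mp (hcross j k hj hk)
  have hmin : ∀ t, L ≤ t → t ≤ U → fmax (fun j => θ j + p j * t) = μ := by
    intro t hLt htU
    rw [hL] at hLt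
    rw [hU] at htU
    refine le_antisymm (Finset.sup'_le _ _ fun j _ => ?_) (hlower t)
    rcases lt_trichotomy (p j) 0 with hj | hj | hj
    · have h := (Finset.sup'_le_iff _ _).mp hLt j (by simp [hj])
      rw [div_le_iff_of_neg hj] at h
      linarith
    · simpa [hj] using hzero j hj
    · have h := (Finset.le_inf'_iff _ _).mp htU j (by simp [hj])
      rw [le_div_iff₀ hj] at h
      linarith
  refine ⟨hLU, hmin, L, le_antisymm (le_ciInf fun s => ?_) (ciInf_le ⟨μ, ?_⟩ L)⟩
  · rw [hmin L le_rfl hLU]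
    exact hlower s
  · rintro _ ⟨s, rfl⟩
    exact hlower s
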